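/- Let (X,d) be a finite nonempty ultrametric space. Then any two minimal UGVL-extensions of (X,d) are isometric, i.e., if (Y₁,ρ₁) and (Y₂,ρ₂) are both minimal UGVL-extensions of (X,d), then there exists a bijective distance-preserving map from Y₁ onto Y₂. -/

import Mathlib

/-- `d` is an ultrametric on `X`: a nonnegative, symmetric function vanishing
exactly on the diagonal and satisfying the strong triangle inequality. -/
def IsUltrametricOn {X : Type*} (d : X → X → ℝ) : Prop :=
  (∀ x y, 0 ≤ d x y) ∧ (∀ x y, d x y = d y x) ∧
  (∀ x y, d x y = 0 ↔ x = y) ∧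
  (∀ x y z, d x y ≤ max (d x z) (d z y))

/-- `B` is an open ball of the space `(X, d)`. -/
def IsOpenBallOf {X : Type*} (d : X → X → ℝ) (B : Set X) : Prop :=
  ∃ c : X, ∃ r : ℝ, 0 < r ∧ B = {x | d c x < r}

/-- `C` is a centered sphere of the space `(X, d)`. -/
def IsCenteredSphereOf {X : Type*} (d : X → X → ℝ) (C : Set X) : Prop :=
  ∃ c ∈ C, ∃ r : ℝ, 0 ≤ r ∧ C = {x | d x c = r} ∪ {c}

/-- The diameter `sup {d x y : x, y ∈ A}` of a subset `A` of `(X, d)`. -/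
noncomputable def setDiam {X : Type*} (d : X → X → ℝ) (A : Set X) : ℝ :=
  sSup {r | ∃ x ∈ A, ∃ y ∈ A, r = d x y}

/-- A space is locally finite if all of its open balls are finite sets. -/
def IsLocallyFiniteOn {X : Type*} (d : X → X → ℝ) : Prop :=
  ∀ B : Set X, IsOpenBallOf d B → B.Finite

/-- The maximum of the (nonnegative) labels of the vertices of a walk `p`. -/
def walkMax {X : Type*} {T : SimpleGraph X} (l : X → ℝ) {u v : X} (p : T.Walk u v) : ℝ :=
  (p.support.map l).foldr max 0

/-- The function `d` is generated by the tree `T` with nonnegative vertex labeling `l`,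
i.e. `d u u = 0` and, for `u ≠ v`, `d u v` is the maximum of the labels of the vertices
on the (unique) path joining `u` and `v` in `T`. -/
def GeneratedBy {X : Type*} (d : X → X → ℝ) (T : SimpleGraph X) (l : X → ℝ) : Prop :=
  T.IsTree ∧ (∀ x, 0 ≤ l x) ∧ (∀ u, d u u = 0) ∧
  ∀ u v : X, u ≠ v → ∀ p : T.Walk u v, p.IsPath → d u v = walkMax l p

/-- `(X, d)` belongs to the class UGVL: it is generated by some labeled tree. -/
def IsUGVL {X : Type*} (d : X → X → ℝ) : Prop :=
  ∃ (T : SimpleGraph X) (l : X → ℝ), GeneratedBy d T l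

/-- `(Y, ρ)` is an UGVL-extension of `(X, d)`: an ultrametric UGVL-space into which
`(X, d)` embeds isometrically. -/
def IsUGVLExtension {X Y : Type*} (d : X → X → ℝ) (ρ : Y → Y → ℝ) : Prop :=
  IsUltrametricOn ρ ∧ IsUGVL ρ ∧ ∃ Φ : X → Y, ∀ x y : X, ρ (Φ x) (Φ y) = d x y

/-- An UGVL-extension is minimal if no proper subspace of it is an UGVL-extension of
`(X, d)`. -/
def IsMinimalUGVLExtension {X Y : Type*} (d : X → X → ℝ) (ρ : Y → Y → ℝ) : Prop :=
  IsUGVLExtension d ρ ∧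
  ∀ Y₀ : Set Y, Y₀ ≠ Set.univ → ¬ IsUGVLExtension d (fun a b : Y₀ => ρ a b)

theorem le_walkMax {X : Type*} {T : SimpleGraph X} (l : X → ℝ) {u v w : X} (p : T.Walk u v)
    (hw : w ∈ p.support) : l w ≤ walkMax l p := by
  have key : ∀ L : List X, w ∈ L → l w ≤ (L.map l).foldr max 0 := by
    intro L
    induction L with
    | nil => simp
    | cons a L ih =>
      intro h
      rcases List.mem_cons.1 h with rfl | h
      · simp
      · simp [ih h]
  exact key _ hw

theorem walkMax_le {X : Type*} {T : SimpleGraph X} (l : X → ℝ) {u v : X} (p : T.Walk u v) {r : ℝ}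
    (hr : 0 ≤ r) (h : ∀ w ∈ p.support, l w ≤ r) : walkMax l p ≤ r := by
  have key : ∀ L : List X, (∀ w ∈ L, l w ≤ r) → (L.map l).foldr max 0 ≤ r := by
    intro L
    induction L with
    | nil => simpa using hr
    | cons a L ih =>
      intro h
      simp only [List.map_cons, List.foldr_cons, max_le_iff]
      exact ⟨h a (by simp), ih fun w hw => h w (by simp [hw])⟩
  exact key _ h

theorem exists_mem_support_walkMax_le {X : Type*} {T : SimpleGraph X} (l : X → ℝ) {u v : X}
    (p : T.Walk u v) (h0 : 0 < walkMax l p) : ∃ w ∈ p.support, walkMax l p ≤ l w := by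
  have key : ∀ L : List X, 0 < (L.map l).foldr max 0 → ∃ w ∈ L, (L.map l).foldr max 0 ≤ l w := by
    intro L
    induction L with
    | nil => simp
    | cons a L ih =>
      intro h
      simp only [List.map_cons, List.foldr_cons] at h ⊢
      rcases le_total ((L.map l).foldr max 0) (l a) with h1 | h1
      · exact ⟨a, by simp, by simp [h1]⟩
      · rw [max_eq_right h1] at h ⊢
        obtain ⟨w, hw, hle⟩ := ih h
        exact ⟨w, by simp [hw], hle⟩
  exact key _ h0

/-- Every closed ball whose radius is the positive distance between two of its points
has a point whose distance to all other points of the space is at least that radius. -/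
def HasCenters {Y : Type*} (ρ : Y → Y → ℝ) : Prop :=
  ∀ u v, u ≠ v → ∃ w, ρ u w ≤ ρ u v ∧ ∀ x, x ≠ w → ρ u v ≤ ρ w x

theorem IsUGVL.hasCenters {Y : Type*} {ρ : Y → Y → ℝ} (hρ : IsUltrametricOn ρ) (h : IsUGVL ρ) :
    HasCenters ρ := by
  classical
  obtain ⟨T, l, hT, -, -, hpath⟩ := h
  obtain ⟨hnn, -, hzero, -⟩ := hρ
  intro u v huv
  obtain ⟨p, hp⟩ := (hT.1.preconnected u v).exists_isPath
  have huv' : 0 < ρ u v := lt_of_le_of_ne (hnn u v) fun h => huv ((hzero u v).1 h.symm)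
  rw [hpath u v huv p hp] at huv' ⊢
  obtain ⟨w, hw, hle⟩ := exists_mem_support_walkMax_le l p huv'
  refine ⟨w, ?_, fun x hx => ?_⟩
  · by_cases huw : u = w
    · rw [(hzero u w).2 huw]
      exact huv'.le
    · rw [hpath u w huw _ (hp.takeUntil hw)]
      exact walkMax_le l _ huv'.le fun z hz =>
        le_walkMax l p (p.support_takeUntil_subset_support hw hz)
  · obtain ⟨q, hq⟩ := (hT.1.preconnected w x).exists_isPath
    rw [hpath w x hx.symm q hq]
    exact hle.trans (le_walkMax l q q.start_mem_support)

theorem exists_nearest_label {Y : Type*} [Finite Y] {ρ : Y → Y → ℝ} (hnn : ∀ x y, 0 ≤ ρ x y) :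
    ∃ l : Y → ℝ, (∀ x, 0 ≤ l x) ∧ (∀ x y, y ≠ x → l x ≤ ρ x y) ∧
      ∀ x y, y ≠ x → ∃ z, z ≠ x ∧ l x = ρ x z := by
  have key : ∀ x, ∃ r : ℝ, 0 ≤ r ∧ (∀ y, y ≠ x → r ≤ ρ x y) ∧
      ∀ y, y ≠ x → ∃ z, z ≠ x ∧ r = ρ x z := by
    intro x
    rcases Set.eq_empty_or_nonempty {y | y ≠ x} with h | h
    · refine ⟨0, le_rfl, fun y _ => hnn x y, fun y hy => ?_⟩
      exact absurd (show y ∈ {y | y ≠ x} from hy) (by simp [h])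
    · obtain ⟨z, hz, hmin⟩ := Set.exists_min_image _ (ρ x) (Set.toFinite _) h
      exact ⟨ρ x z, hnn x z, hmin, fun _ _ => ⟨z, hz, rfl⟩⟩
  choose l h using key
  exact ⟨l, fun x => (h x).1, fun x => (h x).2.1, fun x => (h x).2.2⟩

theorem exists_injective_mono_key {Y : Type*} [Finite Y] (l : Y → ℝ) :
    ∃ f : Y → ℝ ×ₗ Fin (Nat.card Y), Function.Injective f ∧ ∀ x y, f x ≤ f y → l x ≤ l y := by
  refine ⟨fun x => toLex (l x, Finite.equivFin Y x), fun x y h => ?_, fun x y h => ?_⟩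
  · have := congrArg (fun z => (ofLex z).2) h
    simpa using this
  · rw [Prod.Lex.toLex_le_toLex] at h
    rcases h with h | h
    · exact h.le
    · exact h.1.le

/-- The graph joining every `x` to `par x` whenever the latter has the larger key. -/
def parentGraph {Y K : Type*} [LinearOrder K] (f : Y → K) (par : Y → Y) : SimpleGraph Y :=
  SimpleGraph.fromRel fun x y => f x < f y ∧ y = par x

theorem parentGraph_isTree {Y K : Type*} [Finite Y] [Nonempty Y] [LinearOrder K] (f : Y → K)
    (par : Y → Y) (hc : (parentGraph f par).Connected) : (parentGraph f par).IsTree := by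
  classical
  rw [SimpleGraph.isTree_iff_connected_and_card]
  refine ⟨hc, le_antisymm ?_ hc.card_vert_le_card_edgeSet_add_one⟩
  obtain ⟨m, hm⟩ := Finite.exists_max f
  have hsub : (parentGraph f par).edgeSet ⊆ (fun x => s(x, par x)) '' {x | x ≠ m} := by
    intro e
    induction e with
    | _ x y =>
      intro he
      rw [SimpleGraph.mem_edgeSet, parentGraph, SimpleGraph.fromRel_adj] at he
      rcases he.2 with ⟨h1, h2⟩ | ⟨h1, h2⟩
      · exact ⟨x, fun h => absurd (hm y) (by rw [← h]; exact not_le.2 h1), by rw [h2]⟩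
      · exact ⟨y, fun h => absurd (hm x) (by rw [← h]; exact not_le.2 h1),
          by rw [h2]; exact Sym2.eq_swap⟩
  have h1 : (parentGraph f par).edgeSet.ncard ≤ {x | x ≠ m}.ncard :=
    (Set.ncard_le_ncard hsub (Set.toFinite _)).trans (Set.ncard_image_le (Set.toFinite _))
  have h2 : ({m}ᶜ : Set Y).ncard + ({m} : Set Y).ncard = Nat.card Y := by
    rw [add_comm]
    exact Set.ncard_add_ncard_compl _
  rw [Set.ncard_singleton] at h2
  have h3 : {x | x ≠ m} = ({m}ᶜ : Set Y) := rfl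
  rw [h3] at h1
  have h4 : Nat.card (parentGraph f par).edgeSet = (parentGraph f par).edgeSet.ncard := rfl
  omega

theorem exists_parent {Y K : Type*} [Finite Y] [LinearOrder K] {ρ : Y → Y → ℝ} {l : Y → ℝ}
    (hC : HasCenters ρ) (hl : ∀ x y, y ≠ x → ∃ z, z ≠ x ∧ l x = ρ x z) (f : Y → K)
    (hf : ∀ x y, f x ≤ f y → l x ≤ l y) (x : Y) (hx : ∃ y, f x < f y) :
    ∃ p, f x < f p ∧ (∀ y, f x < f y → ρ x p ≤ ρ x y) ∧ ρ x p ≤ max (l x) (l p) := by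
  obtain ⟨p, hp, hmin⟩ := Set.exists_min_image {y | f x < f y} (ρ x) (Set.toFinite _) hx
  have hpx : x ≠ p := fun h => lt_irrefl _ (h ▸ hp : f p < f p)
  obtain ⟨w, hw, hw'⟩ := hC x p hpx
  have hlw : ρ x p ≤ l w := by
    obtain ⟨y, hy⟩ : ∃ y, y ≠ w := by
      by_cases h : x = w
      · exact ⟨p, h ▸ hpx.symm⟩
      · exact ⟨x, h⟩
    obtain ⟨z, hz, h⟩ := hl w y hy
    rw [h]
    exact hw' z hz
  rcases lt_or_ge (f x) (f w) with h | h
  · exact ⟨w, h, fun y hy => hw.trans (hmin y hy), (hw.trans hlw).trans (le_max_right _ _)⟩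
  · exact ⟨p, hp, hmin, (hlw.trans (hf _ _ h)).trans (le_max_left _ _)⟩

theorem exists_parentGraph_walk {Y K : Type*} [Finite Y] [LinearOrder K] {ρ : Y → Y → ℝ}
    (hρ : IsUltrametricOn ρ) (f : Y → K) (hf : Function.Injective f) (par : Y → Y)
    (hpar : ∀ x, (∃ y, f x < f y) → f x < f (par x) ∧ ∀ y, f x < f y → ρ x (par x) ≤ ρ x y)
    (u v : Y) : ∃ p : (parentGraph f par).Walk u v, ∀ z ∈ p.support, ρ u z ≤ ρ u v := by
  obtain ⟨hnn, hsymm, hzero, htri⟩ := hρ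
  obtain ⟨m, hm, hmax⟩ :=
    Set.exists_max_image {z | ρ u z ≤ ρ u v} f (Set.toFinite _) ⟨v, le_refl (ρ u v)⟩
  have key : ∀ x, ρ u x ≤ ρ u v →
      ∃ p : (parentGraph f par).Walk x m, ∀ z ∈ p.support, ρ u z ≤ ρ u v := by
    have wf : WellFounded fun x y : Y => f y < f x :=
      @Finite.wellFounded_of_trans_of_irrefl Y _ _ ⟨fun _ _ _ h1 h2 => lt_trans h2 h1⟩
        ⟨fun _ => lt_irrefl _⟩
    intro x
    induction x using wf.induction with
    | _ x ih =>
      intro hx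
      rcases (hmax x hx).eq_or_lt with h | h
      · obtain rfl := hf h
        exact ⟨.nil, by simpa using hx⟩
      · obtain ⟨h1, h2⟩ := hpar x ⟨m, h⟩
        have hxm : ρ x m ≤ ρ u v := by
          refine (htri x m u).trans (max_le ?_ hm)
          rw [hsymm]
          exact hx
        have hux : ρ u (par x) ≤ ρ u v := (htri _ _ x).trans (max_le hx ((h2 m h).trans hxm))
        obtain ⟨p, hp⟩ := ih (par x) h1 hux
        have hadj : (parentGraph f par).Adj x (par x) := by
          rw [parentGraph, SimpleGraph.fromRel_adj]
          exact ⟨fun h => h1.ne (congrArg f h), Or.inl ⟨h1, rfl⟩⟩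
        refine ⟨.cons hadj p, fun z hz => ?_⟩
        rcases List.mem_cons.1 (by simpa using hz) with rfl | hz
        · exact hx
        · exact hp z hz
  obtain ⟨p, hp⟩ := key u (by rw [(hzero u u).2 rfl]; exact hnn u v)
  obtain ⟨q, hq⟩ := key v le_rfl
  refine ⟨p.append q.reverse, fun z hz => ?_⟩
  rw [SimpleGraph.Walk.mem_support_append_iff, SimpleGraph.Walk.support_reverse,
    List.mem_reverse] at hz
  exact hz.elim (hp z) (hq z)

theorem HasCenters.isUGVL {Y : Type*} [Finite Y] [Nonempty Y] {ρ : Y → Y → ℝ}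
    (hρ : IsUltrametricOn ρ) (hC : HasCenters ρ) : IsUGVL ρ := by
  classical
  obtain ⟨hnn, hsymm, hzero, htri⟩ := id hρ
  obtain ⟨l, hl0, hl1, hl2⟩ := exists_nearest_label hnn
  obtain ⟨f, hf, hfl⟩ := exists_injective_mono_key l
  have hex : ∀ x, ∃ p, (∃ y, f x < f y) → f x < f p ∧ (∀ y, f x < f y → ρ x p ≤ ρ x y) ∧
      ρ x p ≤ max (l x) (l p) := by
    intro x
    by_cases hx : ∃ y, f x < f y
    · obtain ⟨p, hp⟩ := exists_parent hC hl2 f hfl x hx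
      exact ⟨p, fun _ => hp⟩
    · exact ⟨x, fun h => absurd h hx⟩
  choose par hpar using hex
  have hwalk := exists_parentGraph_walk hρ f hf par fun x hx =>
    ⟨(hpar x hx).1, (hpar x hx).2.1⟩
  have hT : (parentGraph f par).IsTree :=
    parentGraph_isTree f par ⟨fun u v => (hwalk u v).choose.reachable⟩
  have hedge : ∀ x y, (parentGraph f par).Adj x y → ρ x y ≤ max (l x) (l y) := by
    intro x y h
    rw [parentGraph, SimpleGraph.fromRel_adj] at h
    rcases h.2 with ⟨h1, rfl⟩ | ⟨h1, rfl⟩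
    · exact (hpar x ⟨_, h1⟩).2.2
    · rw [hsymm, max_comm]
      exact (hpar y ⟨_, h1⟩).2.2
  refine ⟨parentGraph f par, l, hT, hl0, fun u => (hzero u u).2 rfl, fun u v huv p hp =>
    le_antisymm ?_ ?_⟩
  · clear huv hp
    induction p with
    | nil =>
      rw [(hzero _ _).2 rfl]
      exact (hl0 _).trans (le_walkMax l _ (SimpleGraph.Walk.start_mem_support _))
    | cons h p ih =>
      refine (htri _ _ _).trans (max_le ((hedge _ _ h).trans (max_le ?_ ?_)) (ih.trans ?_))
      · exact le_walkMax l _ (by simp)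
      · exact le_walkMax l _ (by simp)
      · exact walkMax_le l _ ((hl0 _).trans (le_walkMax l _ (SimpleGraph.Walk.start_mem_support _)))
          fun w hw => le_walkMax l _ (by simp [hw])
  · obtain ⟨q, hq⟩ := hwalk u v
    have hpq : p = q.bypass :=
      congrArg Subtype.val ((hT.2.subsingleton_path u v).elim ⟨p, hp⟩ ⟨q.bypass, q.bypass_isPath⟩)
    refine walkMax_le l p (hnn u v) fun z hz => ?_
    have hz' : ρ u z ≤ ρ u v := hq z (q.support_bypass_subset_support (hpq ▸ hz))
    by_cases hzu : u = z
    · rw [← hzu]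
      exact hl1 u v huv.symm
    · exact (hl1 z u hzu).trans (by rwa [hsymm])

/-- The distance on `X × ℝ` for which `(c, r)` behaves like a point at distance `r` from the
nearest points and at distance `max r (d c x)` from `x`. -/
noncomputable def nodeDist {X : Type*} (d : X → X → ℝ) (h k : X × ℝ) : ℝ :=
  open Classical in if h = k then 0 else max (max h.2 k.2) (d h.1 k.1)

/-- The points of `X`, with radius zero, together with one node `(c, r)` for each closed ball of
diameter `r > 0` all of whose points have another point at distance less than `r`. The function
`sel` selects the representative `c` of a ball. -/
def nodes {X : Type*} (d : X → X → ℝ) (sel : Set X → X) : Set (X × ℝ) :=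
  {h | (∃ c, d h.1 c = h.2) ∧ (h.2 = 0 ∨
    (sel {x | d h.1 x ≤ h.2} = h.1 ∧ ∀ w, d h.1 w ≤ h.2 → ∃ x, x ≠ w ∧ d w x < h.2))}

theorem IsUltrametricOn.closedBall_eq {X : Type*} {d : X → X → ℝ} (hd : IsUltrametricOn d)
    {a b : X} {r : ℝ} (h : d a b ≤ r) : {x | d a x ≤ r} = {x | d b x ≤ r} := by
  obtain ⟨-, hsymm, -, htri⟩ := hd
  ext x
  exact ⟨fun hx => (htri b x a).trans (max_le (hsymm a b ▸ h) hx),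
    fun hx => (htri a x b).trans (max_le h hx)⟩

theorem IsUltrametricOn.exists_dist_eq {X : Type*} {d : X → X → ℝ} (hd : IsUltrametricOn d)
    {a b c : X} {r : ℝ} (h : d a b ≤ r) (hc : d a c = r) : ∃ e, d b e = r := by
  obtain ⟨-, hsymm, -, htri⟩ := hd
  rcases h.eq_or_lt with h | h
  · exact ⟨a, by rw [hsymm, h]⟩
  · refine ⟨c, le_antisymm ?_ ?_⟩
    · exact (htri b c a).trans (max_le (hsymm a b ▸ h.le) hc.le)
    · by_contra! hlt
      exact absurd (htri a c b) (not_le.2 (hc ▸ max_lt h hlt))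

theorem nodes_finite {X : Type*} [Finite X] (d : X → X → ℝ) (sel : Set X → X) :
    (nodes d sel).Finite := by
  refine (Set.finite_range fun p : X × X => (p.1, d p.1 p.2)).subset ?_
  rintro ⟨c, r⟩ ⟨⟨c', hc⟩, -⟩
  exact ⟨(c, c'), by simpa using hc⟩

theorem nodeDist_of_ne {X : Type*} (d : X → X → ℝ) {h k : X × ℝ} (hk : h ≠ k) :
    nodeDist d h k = max (max h.2 k.2) (d h.1 k.1) := if_neg hk

theorem nodeDist_le {X : Type*} {d : X → X → ℝ} (hnn : ∀ x y, 0 ≤ d x y) (h k : X × ℝ) :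
    nodeDist d h k ≤ max (max h.2 k.2) (d h.1 k.1) := by
  unfold nodeDist
  split_ifs
  · exact (hnn _ _).trans (le_max_right _ _)
  · exact le_rfl

theorem nodeDist_hasCenters {X : Type*} {d : X → X → ℝ} (hd : IsUltrametricOn d)
    {sel : Set X → X} (hsel : ∀ B : Set X, B.Nonempty → sel B ∈ B) :
    HasCenters fun h k : nodes d sel => nodeDist d h k := by
  obtain ⟨hnn, hsymm, hzero, htri⟩ := id hd
  rintro ⟨⟨a, s⟩, ⟨a', ha'⟩, ha⟩ ⟨⟨b, t⟩, ⟨b', hb'⟩, hb⟩ huv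
  have huv' : ((a, s) : X × ℝ) ≠ (b, t) := fun h => huv (Subtype.ext h)
  simp only at ha' hb'
  simp only [nodeDist_of_ne d huv']
  generalize hR : max (max s t) (d a b) = R
  have hs : s ≤ R := hR ▸ (le_max_left _ _).trans (le_max_left _ _)
  have ht : t ≤ R := hR ▸ (le_max_right s _).trans (le_max_left _ _)
  have hab : d a b ≤ R := hR ▸ le_max_right _ _
  have hR0 : 0 ≤ R := (hnn _ _).trans hab
  obtain ⟨c, hc⟩ : ∃ c, d a c = R := by
    rcases max_choice (max s t) (d a b) with h | h
    · rcases max_choice s t with h' | h'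
      · exact ⟨a', by rw [ha', ← hR, h, h']⟩
      · have : t = R := by rw [← hR, h, h']
        exact hd.exists_dist_eq (a := b) (by rwa [hsymm]) (hb'.trans this)
    · exact ⟨b, by rw [← hR, h]⟩
  by_cases hbad : ∀ w, d a w ≤ R → ∃ x, x ≠ w ∧ d w x < R
  · have hmem : d a (sel {x | d a x ≤ R}) ≤ R :=
      hsel {x | d a x ≤ R} ⟨a, by simpa [(hzero a a).2 rfl] using hR0⟩
    have hball := hd.closedBall_eq hmem
    refine ⟨⟨(sel {x | d a x ≤ R}, R), hd.exists_dist_eq hmem hc, Or.inr ⟨?_, ?_⟩⟩, ?_, ?_⟩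
    · simp only [← hball]
    · intro w hw
      exact hbad w ((Set.ext_iff.1 hball w).2 hw)
    · exact (nodeDist_le hnn _ _).trans (max_le (max_le hs le_rfl) hmem)
    · intro x hx
      rw [nodeDist_of_ne d fun h => hx (Subtype.ext h.symm)]
      exact (le_max_left _ _).trans (le_max_left _ _)
  · push Not at hbad
    obtain ⟨w, haw, hw⟩ := hbad
    refine ⟨⟨(w, 0), ⟨w, (hzero w w).2 rfl⟩, Or.inl rfl⟩, ?_, ?_⟩
    · exact (nodeDist_le hnn _ _).trans (max_le (max_le hs hR0) haw)
    · rintro ⟨⟨e, q⟩, ⟨e', he⟩, _⟩ hx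
      have hx' : ((w, 0) : X × ℝ) ≠ (e, q) := fun h => hx (Subtype.ext h.symm)
      simp only at he
      rw [nodeDist_of_ne d hx']
      by_cases hew : e = w
      · subst hew
        have hq : e' ≠ e := by
          rintro rfl
          exact hx' (by rw [← he, (hzero _ _).2 rfl])
        exact ((hw e' hq).trans he.le).trans ((le_max_right _ _).trans (le_max_left _ _))
      · exact (hw e hew).trans (le_max_right _ _)

theorem exists_isometry_of_nodes {X Y : Type*} {d : X → X → ℝ} (hd : IsUltrametricOn d)
    (sel : Set X → X) {ρ : Y → Y → ℝ} (hρ : IsUltrametricOn ρ) (hC : HasCenters ρ)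
    {Φ : X → Y} (hΦ : ∀ x y, ρ (Φ x) (Φ y) = d x y) :
    ∃ g : nodes d sel → Y, Function.Injective g ∧
      ∀ h k : nodes d sel, ρ (g h) (g k) = nodeDist d h k := by
  obtain ⟨hnn, hsymm, hzero, htri⟩ := id hd
  obtain ⟨rnn, rsymm, rzero, rtri⟩ := id hρ
  have hinj : ∀ x y, Φ x = Φ y → x = y := fun x y h => by
    rw [← hzero, ← hΦ, h, rzero]
  have key : ∀ h : nodes d sel, ∃ y : Y, ρ (Φ h.1.1) y ≤ h.1.2 ∧ (∀ z, z ≠ y → h.1.2 ≤ ρ y z) ∧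
      (h.1.2 ≠ 0 → ∀ x, Φ x ≠ y) := by
    rintro ⟨⟨c, r⟩, ⟨c', hc⟩, hbad⟩
    simp only at hc hbad ⊢
    by_cases hr : r = 0
    · exact ⟨Φ c, by rw [(rzero _ _).2 rfl, hr], fun z _ => hr ▸ rnn _ _, fun h => absurd hr h⟩
    · have hne : Φ c ≠ Φ c' := by
        intro h
        rw [← rzero, hΦ] at h
        exact hr (hc.symm.trans h)
      obtain ⟨w, hw, hw'⟩ := hC _ _ hne
      rw [hΦ, hc] at hw
      simp only [hΦ, hc] at hw'
      refine ⟨w, hw, hw', fun _ x hx => ?_⟩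
      subst hx
      rw [hΦ] at hw
      obtain ⟨z, hz, hlt⟩ := (hbad.resolve_left hr).2 x hw
      have := hw' (Φ z) fun h => hz (hinj _ _ h)
      rw [hΦ] at this
      exact absurd this (not_le.2 hlt)
  choose g hg1 hg2 hg3 using key
  have hr0 : ∀ h : nodes d sel, 0 ≤ h.1.2 := by
    rintro ⟨⟨c, r⟩, ⟨c', hc⟩, -⟩
    exact (hnn c c').trans hc.le
  have hle : ∀ h k : nodes d sel, g h = g k → k.1.2 ≤ h.1.2 := by
    intro h k hhk
    by_contra! hlt
    have h1 := hg1 h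
    have h2 := hg2 k (Φ h.1.1) (hg3 k ((hr0 h).trans_lt hlt).ne' _)
    rw [hhk, rsymm] at h1
    exact absurd (h2.trans h1) (not_le.2 hlt)
  have hginj : ∀ h k, g h = g k → h = k := by
    intro h k hhk
    have hr : h.1.2 = k.1.2 := le_antisymm (hle _ _ hhk.symm) (hle _ _ hhk)
    have hdk : d h.1.1 k.1.1 ≤ h.1.2 := by
      rw [← hΦ]
      refine (rtri _ _ (g h)).trans (max_le (hg1 h) ?_)
      rw [rsymm, hhk, hr]
      exact hg1 k
    refine Subtype.ext (Prod.ext ?_ hr)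
    rcases h.2.2 with h0 | ⟨hs, -⟩
    · exact (hzero _ _).1 (le_antisymm (hdk.trans h0.le) (hnn _ _))
    · rcases k.2.2 with k0 | ⟨ks, -⟩
      · exact (hzero _ _).1 (le_antisymm (hdk.trans (hr.trans k0).le) (hnn _ _))
      · rw [← hs, ← ks, hd.closedBall_eq hdk, hr]
  refine ⟨g, fun h k => hginj h k, fun h k => ?_⟩
  by_cases hhk : h = k
  · rw [hhk, (rzero _ _).2 rfl, nodeDist, if_pos rfl]
  · have hgne : g h ≠ g k := fun h' => hhk (hginj _ _ h')
    rw [nodeDist_of_ne d fun h' => hhk (Subtype.ext h')]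
    have h1 : h.1.2 ≤ ρ (g h) (g k) := hg2 h _ hgne.symm
    have h2 : k.1.2 ≤ ρ (g h) (g k) := rsymm (g k) (g h) ▸ hg2 k _ hgne
    have h3 := hg1 h
    have h4 := hg1 k
    refine le_antisymm ?_ (max_le (max_le h1 h2) ?_)
    · refine (rtri _ _ (Φ h.1.1)).trans (max_le ?_ ((rtri _ _ (Φ k.1.1)).trans (max_le ?_ ?_)))
      · rw [rsymm]
        exact h3.trans ((le_max_left _ _).trans (le_max_left _ _))
      · rw [hΦ]
        exact le_max_right _ _
      · exact h4.trans ((le_max_right _ _).trans (le_max_left _ _))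
    · rw [← hΦ]
      refine (rtri _ _ (g h)).trans (max_le (h3.trans h1) ((rtri _ _ (g k)).trans
        (max_le le_rfl ?_)))
      rw [rsymm]
      exact h4.trans h2

theorem IsMinimalUGVLExtension.exists_bijective_of_nodes {X Y : Type*} [Finite X] [Nonempty X]
    {d : X → X → ℝ} (hd : IsUltrametricOn d) {sel : Set X → X}
    (hsel : ∀ B : Set X, B.Nonempty → sel B ∈ B) {ρ : Y → Y → ℝ}
    (h : IsMinimalUGVLExtension d ρ) :
    ∃ g : nodes d sel → Y, Function.Bijective g ∧
      ∀ a b : nodes d sel, ρ (g a) (g b) = nodeDist d a b := by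
  obtain ⟨⟨hρ, hU, Φ, hΦ⟩, hmin⟩ := h
  obtain ⟨hnn, hsymm, hzero, htri⟩ := id hd
  obtain ⟨rnn, rsymm, rzero, rtri⟩ := id hρ
  obtain ⟨g, hinj, hg⟩ := exists_isometry_of_nodes hd sel hρ (hU.hasCenters hρ) hΦ
  let ι : X → nodes d sel := fun x => ⟨(x, 0), ⟨x, (hzero x x).2 rfl⟩, Or.inl rfl⟩
  have hι : ∀ x y, ρ (g (ι x)) (g (ι y)) = d x y := by
    intro x y
    rw [hg]
    by_cases hxy : x = y
    · rw [hxy, (hzero y y).2 rfl, nodeDist, if_pos rfl]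
    · rw [nodeDist_of_ne d fun h => hxy (congrArg Prod.fst h)]
      simp [ι, hnn]
  refine ⟨g, ⟨hinj, ?_⟩, hg⟩
  rw [← Set.range_eq_univ]
  by_contra hne
  have hult : IsUltrametricOn fun a b : Set.range g => ρ a b :=
    ⟨fun _ _ => rnn _ _, fun _ _ => rsymm _ _, fun _ _ => (rzero _ _).trans Subtype.ext_iff.symm,
      fun _ _ _ => rtri _ _ _⟩
  have hcent : HasCenters fun a b : Set.range g => ρ a b := by
    rintro ⟨_, a, rfl⟩ ⟨_, b, rfl⟩ hab
    obtain ⟨w, hw, hw'⟩ := nodeDist_hasCenters hd hsel a b fun h => hab (by rw [h])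
    refine ⟨⟨g w, w, rfl⟩, ?_, ?_⟩
    · simpa only [hg] using hw
    · rintro ⟨_, x, rfl⟩ hx
      simpa only [hg] using hw' x fun h => hx (by rw [h])
  have : Finite (nodes d sel) := nodes_finite d sel
  have : Nonempty (nodes d sel) := ‹Nonempty X›.map ι
  exact hmin _ hne ⟨hult, hcent.isUGVL hult, fun x => ⟨g (ι x), ι x, rfl⟩, hι⟩

/-- Any two minimal UGVL-extensions of a finite nonempty ultrametric space `(X, d)`
are isometric. -/
theorem stmt_19 {X Y₁ Y₂ : Type*} [Finite X] (hne : Nonempty X)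
    (d : X → X → ℝ) (hd : IsUltrametricOn d)
    (ρ₁ : Y₁ → Y₁ → ℝ) (ρ₂ : Y₂ → Y₂ → ℝ)
    (h₁ : IsMinimalUGVLExtension d ρ₁) (h₂ : IsMinimalUGVLExtension d ρ₂) :
    ∃ f : Y₁ → Y₂, Function.Bijective f ∧ ∀ a b : Y₁, ρ₂ (f a) (f b) = ρ₁ a b := by
  classical
  obtain ⟨sel, hsel⟩ : ∃ sel : Set X → X, ∀ B : Set X, B.Nonempty → sel B ∈ B :=
    ⟨fun B => if h : B.Nonempty then h.some else hne.some, fun B h => by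
      simpa only [dif_pos h] using h.some_mem⟩
  obtain ⟨g₁, hb₁, hg₁⟩ := h₁.exists_bijective_of_nodes hd hsel
  obtain ⟨g₂, hb₂, hg₂⟩ := h₂.exists_bijective_of_nodes hd hsel
  let e := Equiv.ofBijective g₁ hb₁
  refine ⟨g₂ ∘ e.symm, hb₂.comp e.symm.bijective, fun a b => ?_⟩
  obtain ⟨a, rfl⟩ := e.surjective a
  obtain ⟨b, rfl⟩ := e.surjective b
  simp only [Function.comp_apply, Equiv.symm_apply_apply, hg₂]
  exact (hg₁ a b).symm
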